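/- arXiv:2504.21261 — 6 statements merged into one kernel-verified Lean document; each statement's English description precedes it below -/
import Mathlib

section
/- Let A, B : Ω → ℝ^d be measurable and let g be a C¹ diffeomorphism of ℝ^d with (P^e).map B = ((P^e).map A).map g for every e. Suppose for each e that (P^e).map A = volume.withDensity p^e_A and (P^e).map B = volume.withDensity p^e_B for measurable density functions p^e_A, p^e_B : ℝ^d → ℝ≥0 (volume is Lebesgue measure on ℝ^d). Then for all domain indices e and e′, for Lebesgue-almost every b ∈ ℝ^d: p^e_A(g⁻¹(b)) · p^{e′}_B(b) = p^{e′}_A(g⁻¹(b)) · p^e_B(b), i.e., the ratio of the density of A at g⁻¹(b) to the density of B at b is the same in every domain. -/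
open MeasureTheory
open scoped ENNReal NNReal

/-- A C¹ diffeomorphism: a bijection that is continuously differentiable
with continuously differentiable inverse. -/
def IsC1Diffeo {E : Type*} [NormedAddCommGroup E] [NormedSpace ℝ E] [Nonempty E]
    (g : E → E) : Prop :=
  Function.Bijective g ∧ ContDiff ℝ 1 g ∧ ContDiff ℝ 1 (Function.invFun g)

/-- Change of variables for densities: the pushforward of a measure with density `p` along a C¹
diffeomorphism `g` has density `|det D(g⁻¹)| * p ∘ g⁻¹`. -/
theorem IsC1Diffeo.map_withDensity {E : Type*} [NormedAddCommGroup E] [NormedSpace ℝ E]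
    [FiniteDimensional ℝ E] [MeasurableSpace E] [BorelSpace E]
    (μ : Measure E) [μ.IsAddHaarMeasure] {g : E → E} (hg : IsC1Diffeo g) (p : E → ℝ≥0∞) :
    (μ.withDensity p).map g = μ.withDensity (fun b =>
      ENNReal.ofReal |(fderiv ℝ (Function.invFun g) b).det| * p (Function.invFun g b)) := by
  obtain ⟨hbij, hgC, hhC⟩ := hg
  have hl := Function.leftInverse_invFun hbij.injective
  have hr := Function.rightInverse_invFun hbij.surjective
  ext s hs
  have himage : g ⁻¹' s = Function.invFun g '' s :=
    (Set.image_eq_preimage_of_inverse hr hl ▸ rfl)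
  rw [Measure.map_apply hgC.continuous.measurable hs,
    withDensity_apply _ (hgC.continuous.measurable hs), withDensity_apply _ hs, himage]
  exact lintegral_image_eq_lintegral_abs_det_fderiv_mul μ hs
    (fun x _ => ((hhC.differentiable one_ne_zero) x).hasFDerivAt.hasFDerivWithinAt)
    hr.injective.injOn p

/-- If `A ∼ B` via the diffeomorphism `g` and both have Lebesgue densities in every
domain, then for Lebesgue-a.e. `b`, the ratio of the density of `A` at `g⁻¹ b` to the
density of `B` at `b` is the same in every domain (stated in cross-multiplied form). -/
theorem density_ratio_invariant {Ω : Type*} [MeasurableSpace Ω]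
    (m d : ℕ) (hm : 1 ≤ m) (hd : 1 ≤ d)
    (P : Fin m → Measure Ω) (hP : ∀ e, IsProbabilityMeasure (P e))
    (A B : Ω → (Fin d → ℝ)) (hA : Measurable A) (hB : Measurable B)
    (g : (Fin d → ℝ) → (Fin d → ℝ)) (hg : IsC1Diffeo g)
    (hmap : ∀ e : Fin m, (P e).map B = ((P e).map A).map g)
    (pA pB : Fin m → (Fin d → ℝ) → ℝ≥0)
    (hpA : ∀ e, Measurable (pA e)) (hpB : ∀ e, Measurable (pB e))
    (hdA : ∀ e, (P e).map A = volume.withDensity (fun a => (pA e a : ℝ≥0∞)))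
    (hdB : ∀ e, (P e).map B = volume.withDensity (fun b => (pB e b : ℝ≥0∞))) :
    ∀ e e' : Fin m, ∀ᵐ b ∂(volume : Measure (Fin d → ℝ)),
      pA e (Function.invFun g b) * pB e' b = pA e' (Function.invFun g b) * pB e b := by
  have hdens : ∀ e, ∀ᵐ b ∂(volume : Measure (Fin d → ℝ)), (pB e b : ℝ≥0∞) =
      ENNReal.ofReal |(fderiv ℝ (Function.invFun g) b).det| * pA e (Function.invFun g b) := by
    intro e
    have hprob := hP e
    have hfin : ∫⁻ b, (pB e b : ℝ≥0∞) ≠ ∞ := by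
      rw [← setLIntegral_univ, ← withDensity_apply _ MeasurableSet.univ, ← hdB e,
        Measure.map_apply hB MeasurableSet.univ]
      exact measure_ne_top _ _
    have hJ : Measurable fun b =>
        ENNReal.ofReal |(fderiv ℝ (Function.invFun g) b).det| :=
      (ContinuousLinearMap.continuous_det.comp
        (hg.2.2.continuous_fderiv one_ne_zero)).abs.measurable.ennreal_ofReal
    refine (withDensity_eq_iff (hpB e).coe_nnreal_ennreal.aemeasurable
      (hJ.mul ((hpA e).comp hg.2.2.continuous.measurable).coe_nnreal_ennreal).aemeasurable
      hfin).1 ?_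
    rw [← hdB e, hmap e, hdA e]
    exact hg.map_withDensity volume _
  intro e e'
  filter_upwards [hdens e, hdens e'] with b hb hb'
  rw [← ENNReal.coe_inj, ENNReal.coe_mul, ENNReal.coe_mul, hb, hb']
  ring
end

section
/- Let A, B : Ω → ℝ^d be measurable and let g be a C¹ diffeomorphism of ℝ^d with (P^e).map (g ∘ A) = (P^e).map B for every e (i.e., A and B are similar via g). Suppose for each e that (P^e).map A = volume.withDensity p^e_A and (P^e).map B = volume.withDensity p^e_B for measurable densities p^e_A, p^e_B : ℝ^d → ℝ≥0 satisfying the positivity condition ∑_e p^e_A(a) > 0 and ∑_e p^e_B(b) > 0 for all a, b ∈ ℝ^d. Let Φ_A, Φ_B : ℝ^d → ℝ^m be the density-vectorizations built from (p^e_A)_e and (p^e_B)_e respectively. Then the special random variables Ψ_A := Φ_A ∘ A and Ψ_B := Φ_B ∘ B are identical: for every e, (P^e).map Ψ_A = (P^e).map Ψ_B. -/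
open MeasureTheory
open scoped ENNReal NNReal

/-- The density-vectorization `Φ` built from densities `p¹, …, pᵐ`:
`Φ(v)ₑ = pᵉ(v) / ∑ₑ' pᵉ'(v)` when the sum is positive, and `Φ(v) = 0` otherwise. -/
noncomputable def densVec {V : Type*} {m : ℕ} (p : Fin m → V → ℝ≥0) (v : V) :
    Fin m → ℝ :=
  if 0 < ∑ e' : Fin m, (p e' v : ℝ) then
    fun e => (p e v : ℝ) / ∑ e' : Fin m, (p e' v : ℝ)
  else 0

theorem densVec_apply_of_pos {V : Type*} {m : ℕ} {p : Fin m → V → ℝ≥0} {v : V}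
    (hpos : 0 < ∑ e : Fin m, (p e v : ℝ)) (e : Fin m) :
    densVec p v e = (p e v : ℝ) / ∑ e' : Fin m, (p e' v : ℝ) := by
  simp [densVec, hpos]

theorem densVec_nonneg {V : Type*} {m : ℕ} (p : Fin m → V → ℝ≥0) (v : V) (e : Fin m) :
    0 ≤ densVec p v e := by
  unfold densVec
  split_ifs
  · positivity
  · simp

theorem measurable_densVec {V : Type*} [MeasurableSpace V] {m : ℕ} {p : Fin m → V → ℝ≥0}
    (hp : ∀ e, Measurable (p e)) : Measurable (densVec p) := by
  have hsum : Measurable fun v => ∑ e : Fin m, (p e v : ℝ) :=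
    Finset.measurable_sum _ fun e _ => (hp e).coe_nnreal_real
  exact Measurable.ite (measurableSet_lt measurable_const hsum)
    (measurable_pi_lambda _ fun e => (hp e).coe_nnreal_real.div hsum) measurable_const

theorem measurable_ofReal_densVec {V : Type*} [MeasurableSpace V] {m : ℕ} {p : Fin m → V → ℝ≥0}
    (hp : ∀ e, Measurable (p e)) (e : Fin m) :
    Measurable fun v => ENNReal.ofReal (densVec p v e) :=
  ((measurable_pi_apply e).comp (measurable_densVec hp)).ennreal_ofReal

theorem sum_withDensity_finset {V ι : Type*} [MeasurableSpace V] (μ : Measure V) (s : Finset ι)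
    {f : ι → V → ℝ≥0∞} (hf : ∀ i, Measurable (f i)) :
    ∑ i ∈ s, μ.withDensity (f i) = μ.withDensity (∑ i ∈ s, f i) := by
  classical
  induction s using Finset.induction_on with
  | empty => simp
  | insert i s hi ih =>
    rw [Finset.sum_insert hi, Finset.sum_insert hi, withDensity_add_left (hf i), ih]

/-- The components of the density-vectorization are the densities of the individual measures with
respect to their sum. -/
theorem withDensity_densVec_sum {V : Type*} [MeasurableSpace V] {m : ℕ} (μ : Measure V)
    {p : Fin m → V → ℝ≥0} (hp : ∀ e, Measurable (p e))
    (hpos : ∀ v, 0 < ∑ e : Fin m, (p e v : ℝ)) (e : Fin m) :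
    (∑ e', μ.withDensity fun v => (p e' v : ℝ≥0∞)).withDensity
      (fun v => ENNReal.ofReal (densVec p v e)) = μ.withDensity fun v => (p e v : ℝ≥0∞) := by
  have hp' : ∀ e, Measurable fun v => (p e v : ℝ≥0∞) := fun e => (hp e).coe_nnreal_ennreal
  rw [sum_withDensity_finset μ _ hp',
    ← withDensity_mul μ (by fun_prop) (measurable_ofReal_densVec hp e)]
  congr 1
  ext v
  have hsum : (∑ e', fun v => (p e' v : ℝ≥0∞)) v = ENNReal.ofReal (∑ e', (p e' v : ℝ)) := by
    rw [Finset.sum_apply, ENNReal.ofReal_sum_of_nonneg fun _ _ => NNReal.coe_nonneg _]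
    simp
  rw [Pi.mul_apply, hsum, ← ENNReal.ofReal_mul (hpos v).le, densVec_apply_of_pos (hpos v),
    mul_div_cancel₀ _ (hpos v).ne', ENNReal.ofReal_coe_nnreal]

theorem map_withDensity_comp {V W : Type*} [MeasurableSpace V] [MeasurableSpace W]
    (μ : Measure V) {g : V → W} (hg : Measurable g) {f : W → ℝ≥0∞} (hf : Measurable f) :
    (μ.withDensity (f ∘ g)).map g = (μ.map g).withDensity f := by
  ext s hs
  rw [Measure.map_apply hg hs, withDensity_apply _ (hg hs), withDensity_apply _ hs,
    setLIntegral_map hs hf hg]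
  rfl

theorem IsC1Diffeo.measurableEmbedding {E : Type*} [NormedAddCommGroup E] [NormedSpace ℝ E]
    [MeasurableSpace E] [BorelSpace E] {g : E → E} (hg : IsC1Diffeo g) :
    MeasurableEmbedding g :=
  MeasurableEquiv.measurableEmbedding
    { toFun := g
      invFun := Function.invFun g
      left_inv := Function.leftInverse_invFun hg.1.1
      right_inv := Function.rightInverse_invFun hg.1.2
      measurable_toFun := hg.2.1.continuous.measurable
      measurable_invFun := hg.2.2.continuous.measurable }

/-- If `A ∼ B` via a C¹ diffeomorphism `g`, both have everywhere-positive
(in the summed sense) Lebesgue densities in every domain, then the special random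
variables `Ψ_A = Φ_A ∘ A` and `Ψ_B = Φ_B ∘ B` are identically distributed in
every domain. -/
theorem similar_implies_special_identical {Ω : Type*} [MeasurableSpace Ω]
    (m d : ℕ) (hm : 1 ≤ m) (hd : 1 ≤ d)
    (P : Fin m → Measure Ω) (hP : ∀ e, IsProbabilityMeasure (P e))
    (A B : Ω → (Fin d → ℝ)) (hA : Measurable A) (hB : Measurable B)
    (g : (Fin d → ℝ) → (Fin d → ℝ)) (hg : IsC1Diffeo g)
    (hmap : ∀ e : Fin m, (P e).map (g ∘ A) = (P e).map B)
    (pA pB : Fin m → (Fin d → ℝ) → ℝ≥0)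
    (hpA : ∀ e, Measurable (pA e)) (hpB : ∀ e, Measurable (pB e))
    (hdA : ∀ e, (P e).map A = volume.withDensity (fun a => (pA e a : ℝ≥0∞)))
    (hdB : ∀ e, (P e).map B = volume.withDensity (fun b => (pB e b : ℝ≥0∞)))
    (hposA : ∀ a, 0 < ∑ e : Fin m, (pA e a : ℝ))
    (hposB : ∀ b, 0 < ∑ e : Fin m, (pB e b : ℝ)) :
    ∀ e : Fin m,
      (P e).map (fun ω => densVec pA (A ω)) = (P e).map (fun ω => densVec pB (B ω)) := by
  have hgm := hg.measurableEmbedding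
  have hgA : ∀ e, ((P e).map A).map g = (P e).map B := fun e => by
    rw [Measure.map_map hgm.measurable hA, hmap e]
  have hsum : (∑ e, (P e).map A).map g = ∑ e, (P e).map B := by
    rw [Measure.map_finset_sum' hgm.measurable.aemeasurable]
    exact Finset.sum_congr rfl fun e _ => hgA e
  have hΦA : ∀ e, (∑ e', (P e').map A).withDensity
      (fun v => ENNReal.ofReal (densVec pA v e)) = (P e).map A := fun e => by
    simp only [hdA]
    exact withDensity_densVec_sum volume hpA hposA e
  have hΦB : ∀ e, (∑ e', (P e').map B).withDensity
      (fun v => ENNReal.ofReal (densVec pB v e)) = (P e).map B := fun e => by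
    simp only [hdB]
    exact withDensity_densVec_sum volume hpB hposB e
  have hae : ∀ e, ∀ᵐ v ∂(∑ e', (P e').map A), densVec pA v e = densVec pB (g v) e := fun e => by
    have hB' := measurable_ofReal_densVec hpB e
    have heq : (∑ e', (P e').map A).withDensity (fun v => ENNReal.ofReal (densVec pA v e)) =
        (∑ e', (P e').map A).withDensity ((fun v => ENNReal.ofReal (densVec pB v e)) ∘ g) := by
      apply hgm.map_injective
      rw [map_withDensity_comp _ hgm.measurable hB', hsum, hΦA, hΦB, hgA]
    filter_upwards [(withDensity_eq_iff_of_sigmaFinite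
      (measurable_ofReal_densVec hpA e).aemeasurable
      (hB'.comp hgm.measurable).aemeasurable).1 heq] with v hv
    exact (ENNReal.ofReal_eq_ofReal_iff (densVec_nonneg _ _ _) (densVec_nonneg _ _ _)).1 hv
  intro e
  have hac : (P e).map A ≪ ∑ e', (P e').map A := by
    rw [← hΦA e]
    exact withDensity_absolutelyContinuous _ _
  have hcomp : densVec pA =ᵐ[(P e).map A] densVec pB ∘ g := by
    filter_upwards [hac.ae_le (ae_all_iff.2 hae)] with v hv
    exact funext hv
  calc (P e).map (densVec pA ∘ A) = ((P e).map A).map (densVec pA) :=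
        (Measure.map_map (measurable_densVec hpA) hA).symm
    _ = ((P e).map A).map (densVec pB ∘ g) := Measure.map_congr hcomp
    _ = (P e).map (densVec pB ∘ B) := by
        rw [← Measure.map_map (measurable_densVec hpB) hgm.measurable, hgA,
          Measure.map_map (measurable_densVec hpB) hB]
end

section
/- Let 𝒳, 𝒴, S be measurable spaces. For each domain index e let μ^e be a probability measure on 𝒳 and κ^e a Markov kernel from 𝒳 to 𝒴, and let F : 𝒳 × 𝒴 → S be measurable. If for all a, b ∈ 𝒳 and every e one has (κ^e a).map (fun y => F (a, y)) = (κ^e b).map (fun y => F (b, y)), then for every e the random variables (x, y) ↦ x and (x, y) ↦ F (x, y) are independent under the joint measure μ^e ⊗ₖ κ^e. -/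
open MeasureTheory ProbabilityTheory
open scoped ENNReal NNReal

/-- If, in every domain `e`, all the conditional pushforwards
`(κ e a).map (fun y => F (a, y))` coincide (as `a` ranges over `𝒳`), then in every
domain the coordinate map `(x, y) ↦ x` and the statistic `(x, y) ↦ F (x, y)` are
independent under the joint measure `μ e ⊗ₘ κ e`. -/
theorem identical_conditionals_imply_indep
    {𝒳 𝒴 S : Type*} [MeasurableSpace 𝒳] [MeasurableSpace 𝒴] [MeasurableSpace S]
    (m : ℕ) (hm : 1 ≤ m)
    (μ : Fin m → Measure 𝒳) (hμ : ∀ e, IsProbabilityMeasure (μ e))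
    (κ : Fin m → Kernel 𝒳 𝒴) (hκ : ∀ e, IsMarkovKernel (κ e))
    (F : 𝒳 × 𝒴 → S) (hF : Measurable F)
    (h : ∀ a b : 𝒳, ∀ e : Fin m,
      ((κ e) a).map (fun y => F (a, y)) = ((κ e) b).map (fun y => F (b, y))) :
    ∀ e : Fin m,
      IndepFun (fun p : 𝒳 × 𝒴 => p.1) F ((μ e).compProd (κ e)) := by
  intro e
  have := hμ e
  have := hκ e
  obtain ⟨a₀⟩ : Nonempty 𝒳 := (μ e).nonempty_of_neZero
  rw [indepFun_iff_measure_inter_preimage_eq_mul]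
  intro s t hs ht
  have h_slice (a : 𝒳) : κ e a (Prod.mk a ⁻¹' (F ⁻¹' t)) = κ e a₀ (Prod.mk a₀ ⁻¹' (F ⁻¹' t)) := by
    have h_map := congrArg (fun ν : Measure S => ν t) (h a a₀ e)
    have h_meas (b : 𝒳) : Measurable fun y => F (b, y) := hF.comp measurable_prodMk_left
    simp only [Measure.map_apply (h_meas _) ht] at h_map
    exact h_map
  have h_inter (s : Set 𝒳) (hs : MeasurableSet s) :
      ((μ e).compProd (κ e)) (Prod.fst ⁻¹' s ∩ F ⁻¹' t)
        = μ e s * κ e a₀ (Prod.mk a₀ ⁻¹' (F ⁻¹' t)) := by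
    have h_ind (a : 𝒳) : κ e a (Prod.mk a ⁻¹' (Prod.fst ⁻¹' s ∩ F ⁻¹' t))
        = s.indicator (fun _ => κ e a₀ (Prod.mk a₀ ⁻¹' (F ⁻¹' t))) a := by
      by_cases ha : a ∈ s
      · rw [Set.indicator_of_mem ha, ← h_slice a]
        congr 1
        ext y
        simp [ha]
      · rw [Set.indicator_of_notMem ha]
        convert measure_empty (μ := κ e a)
        ext y
        simp [ha]
    rw [Measure.compProd_apply ((measurable_fst hs).inter (hF ht)), lintegral_congr h_ind,
      lintegral_indicator_const hs, mul_comm]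
  have h_fst : ((μ e).compProd (κ e)) (Prod.fst ⁻¹' s) = μ e s := by
    rw [← Measure.map_apply measurable_fst hs]
    exact congrArg (fun ν : Measure 𝒳 => ν s) (Measure.fst_compProd (μ e) (κ e))
  have h_snd := h_inter Set.univ MeasurableSet.univ
  rw [Set.preimage_univ, Set.univ_inter, measure_univ, one_mul] at h_snd
  rw [h_inter s hs, h_fst, h_snd]
end

section
/- Let 𝒳 be a countable measurable space in which singletons are measurable, and let 𝒴, S be measurable spaces. For each domain index e let μ^e be a probability measure on 𝒳 with μ^e({a}) > 0 for every a ∈ 𝒳, let κ^e be a Markov kernel from 𝒳 to 𝒴, and let F : 𝒳 × 𝒴 → S be measurable. If for every e the random variables (x, y) ↦ x and (x, y) ↦ F (x, y) are independent under the joint measure μ^e ⊗ₖ κ^e, then for all a, b ∈ 𝒳 and every e one has (κ^e a).map (fun y => F (a, y)) = (κ^e b).map (fun y => F (b, y)). -/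
open MeasureTheory ProbabilityTheory
open scoped ENNReal NNReal

/-- If the first coordinate and `F` are independent under `μ ⊗ₘ κ`, then at every atom `a` of `μ`
the conditional law of `F` given `a` is its marginal law. -/
theorem map_kernel_eq_map_compProd_of_indepFun {α β γ : Type*} [MeasurableSpace α]
    [MeasurableSingletonClass α] [MeasurableSpace β] [MeasurableSpace γ]
    {μ : Measure α} [IsFiniteMeasure μ] {κ : Kernel α β} [IsMarkovKernel κ]
    {F : α × β → γ} (hF : Measurable F)
    (h : IndepFun (fun p : α × β => p.1) F (μ.compProd κ)) {a : α} (ha : μ {a} ≠ 0) :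
    (κ a).map (fun y => F (a, y)) = (μ.compProd κ).map F := by
  ext t ht
  have hs : MeasurableSet ((fun p : α × β => p.1) ⁻¹' {a}) :=
    measurable_fst (measurableSet_singleton a)
  have hFa : Measurable fun y => F (a, y) := hF.comp measurable_prodMk_left
  have h_atom : (μ.compProd κ) ((fun p : α × β => p.1) ⁻¹' {a}) = μ {a} := by
    have : (fun p : α × β => p.1) ⁻¹' {a} = {a} ×ˢ Set.univ := by ext; simp
    rw [this, Measure.compProd_apply_prod (measurableSet_singleton a) MeasurableSet.univ,
      lintegral_singleton, measure_univ, one_mul]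
  have h_inter : (μ.compProd κ) ((fun p : α × β => p.1) ⁻¹' {a} ∩ F ⁻¹' t)
      = μ {a} * κ a ((fun y => F (a, y)) ⁻¹' t) := by
    have : (fun p : α × β => p.1) ⁻¹' {a} ∩ F ⁻¹' t
        = {a} ×ˢ ((fun y => F (a, y)) ⁻¹' t) := by
      ext ⟨x, y⟩
      simp only [Set.mem_inter_iff, Set.mem_preimage, Set.mem_singleton_iff, Set.mem_prod]
      exact and_congr_right fun hx => by rw [hx]
    rw [this, Measure.compProd_apply_prod (measurableSet_singleton a) (hFa ht),
      lintegral_singleton, mul_comm]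
  rw [Measure.map_apply hFa ht, Measure.map_apply hF ht]
  have h_mul := h.measure_inter_preimage_eq_mul {a} t (measurableSet_singleton a) ht
  rw [h_inter, h_atom] at h_mul
  exact (ENNReal.mul_right_inj ha (measure_ne_top μ _)).1 h_mul

/-- Converse direction over a countable cause space with positive point masses:
if in every domain `e` the coordinate map `(x, y) ↦ x` and the statistic
`(x, y) ↦ F (x, y)` are independent under `μ e ⊗ₘ κ e`, then all the conditional
pushforwards `(κ e a).map (fun y => F (a, y))` coincide as `a` ranges over `𝒳`. -/
theorem indep_implies_identical_conditionals
    {𝒳 𝒴 S : Type*} [MeasurableSpace 𝒳] [Countable 𝒳] [MeasurableSingletonClass 𝒳]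
    [MeasurableSpace 𝒴] [MeasurableSpace S]
    (m : ℕ) (hm : 1 ≤ m)
    (μ : Fin m → Measure 𝒳) (hμ : ∀ e, IsProbabilityMeasure (μ e))
    (hpos : ∀ (e : Fin m) (a : 𝒳), 0 < (μ e) {a})
    (κ : Fin m → Kernel 𝒳 𝒴) (hκ : ∀ e, IsMarkovKernel (κ e))
    (F : 𝒳 × 𝒴 → S) (hF : Measurable F)
    (hindep : ∀ e : Fin m,
      IndepFun (fun p : 𝒳 × 𝒴 => p.1) F ((μ e).compProd (κ e))) :
    ∀ a b : 𝒳, ∀ e : Fin m,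
      ((κ e) a).map (fun y => F (a, y)) = ((κ e) b).map (fun y => F (b, y)) := by
  intro a b e
  have := hμ e
  have := hκ e
  rw [map_kernel_eq_map_compProd_of_indepFun hF (hindep e) (hpos e a).ne',
    map_kernel_eq_map_compProd_of_indepFun hF (hindep e) (hpos e b).ne']
end

section
/- Let α and β be countable types (with the discrete measurable structure), let A : Ω → α and B : Ω → β be measurable, and let g : α ≃ β be a bijection such that (P^e).map (g ∘ A) = (P^e).map B for every e. Define Φ_A : α → ℝ^m by Φ_A(a)_e := P^e(A = a) / ∑_{e'} P^{e'}(A = a) when ∑_{e'} P^{e'}(A = a) > 0 and Φ_A(a) := 0 otherwise, and define Φ_B : β → ℝ^m analogously from the point masses of B. Then for every e, (P^e).map (Φ_A ∘ A) = (P^e).map (Φ_B ∘ B). -/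
open MeasureTheory
open scoped ENNReal NNReal

/-- The discrete density-vectorization built from the point masses of `A`:
`Φ_A(a)ₑ = Pᵉ(A = a) / ∑ₑ' Pᵉ'(A = a)` when the sum is positive, `0` otherwise. -/
noncomputable def discVec {Ω α : Type*} [MeasurableSpace Ω] {m : ℕ}
    (P : Fin m → Measure Ω) (A : Ω → α) (a : α) : Fin m → ℝ :=
  if 0 < ∑ e' : Fin m, ((P e') {ω | A ω = a}).toReal then
    fun e => ((P e) {ω | A ω = a}).toReal / ∑ e' : Fin m, ((P e') {ω | A ω = a}).toReal
  else 0

/-- If `g ∘ A` and `B` have the same law in every domain, then `discVec` of `A` at `a`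
agrees with `discVec` of `B` at `g a`. -/
theorem discVec_eq_discVec_apply_of_map_eq {Ω α β : Type*} [MeasurableSpace Ω] {m : ℕ}
    (P : Fin m → Measure Ω) [MeasurableSpace β] [MeasurableSingletonClass β]
    {A : Ω → α} {B : Ω → β} {g : α → β} (hg : Function.Injective g)
    (hgA : Measurable fun ω => g (A ω)) (hB : Measurable B)
    (hmap : ∀ e, (P e).map (fun ω => g (A ω)) = (P e).map B) (a : α) :
    discVec P A a = discVec P B (g a) := by
  have key : ∀ e, P e {ω | A ω = a} = P e {ω | B ω = g a} := by
    intro e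
    have h := congrArg (fun μ : Measure β => μ {g a}) (hmap e)
    simp only [Measure.map_apply hgA (measurableSet_singleton _),
      Measure.map_apply hB (measurableSet_singleton _)] at h
    simpa [Set.preimage, hg.eq_iff] using h
  simp only [discVec, key]

/-- Discrete analogue of the similarity result: if `A` and `B` (valued in countable
discrete spaces) are similar via a bijection `g`, i.e. `(P e).map (g ∘ A) = (P e).map B`
in every domain, then the special random variables `Ψ_A = Φ_A ∘ A` and `Ψ_B = Φ_B ∘ B`
are identically distributed in every domain. -/
theorem discrete_similar_implies_special_identical {Ω : Type*} [MeasurableSpace Ω]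
    (m : ℕ) (hm : 1 ≤ m)
    (P : Fin m → Measure Ω) (hP : ∀ e, IsProbabilityMeasure (P e))
    {α β : Type*} [Countable α] [Countable β]
    [MeasurableSpace α] [DiscreteMeasurableSpace α]
    [MeasurableSpace β] [DiscreteMeasurableSpace β]
    (A : Ω → α) (B : Ω → β) (hA : Measurable A) (hB : Measurable B)
    (g : α ≃ β)
    (hmap : ∀ e : Fin m, (P e).map (fun ω => g (A ω)) = (P e).map B) :
    ∀ e : Fin m,
      (P e).map (fun ω => discVec P A (A ω)) = (P e).map (fun ω => discVec P B (B ω)) := by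
  intro e
  have hgA : Measurable fun ω => g (A ω) := (Measurable.of_discrete (f := g)).comp hA
  have hΦ : Measurable (discVec P B) := Measurable.of_discrete
  simp only [discVec_eq_discVec_apply_of_map_eq P g.injective hgA hB hmap]
  calc (P e).map (fun ω => discVec P B (g (A ω)))
      = ((P e).map fun ω => g (A ω)).map (discVec P B) := (Measure.map_map hΦ hgA).symm
    _ = ((P e).map B).map (discVec P B) := by rw [hmap e]
    _ = (P e).map (fun ω => discVec P B (B ω)) := Measure.map_map hΦ hB
end

section
/- Let Ω be a standard Borel space with a probability measure μ, let X : Ω → ℝ and E : Ω → ℝ be measurable and independent under μ, let f : ℝ × ℝ → ℝ be measurable, and set Y := (ω ↦ f (X ω, E ω)). Then for (μ.map X)-almost every x ∈ ℝ, the conditional distribution of Y given X evaluated at x equals the pushforward of the law of E by the section of f at x: condDistrib Y X μ x = (μ.map E).map (fun t => f (x, t)). -/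
open MeasureTheory ProbabilityTheory
open scoped ENNReal NNReal

/-- In a structural model `Y = f (X, E)` with `X ⫫ E`, the regular conditional
distribution of the effect `Y` given the cause `X` at the point `x` is the law of the
noise `E` pushed forward through the fixed-cause functional `f (x, ·)`,
for `(μ.map X)`-almost every `x`. -/
theorem condDistrib_eq_map_of_indep {Ω : Type*} [MeasurableSpace Ω]
    [StandardBorelSpace Ω]
    (μ : Measure Ω) (hμ : IsProbabilityMeasure μ)
    (X E : Ω → ℝ) (hX : Measurable X) (hE : Measurable E)
    (hindep : IndepFun X E μ)
    (f : ℝ × ℝ → ℝ) (hf : Measurable f)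
    (Y : Ω → ℝ) (hY : Y = fun ω => f (X ω, E ω)) :
    ∀ᵐ x ∂(μ.map X),
      condDistrib Y X μ x = (μ.map E).map (fun t => f (x, t)) := by
  have hY_meas : Measurable Y := by subst hY; fun_prop
  have : IsProbabilityMeasure (μ.map E) := Measure.isProbabilityMeasure_map hE.aemeasurable
  have : IsProbabilityMeasure (μ.map X) := Measure.isProbabilityMeasure_map hX.aemeasurable
  let κ : Kernel ℝ ℝ := (Kernel.id ×ₖ Kernel.const ℝ (μ.map E)).map f
  have : IsMarkovKernel κ := Kernel.IsMarkovKernel.map _ hf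
  have hκ (x : ℝ) : κ x = (μ.map E).map (fun t => f (x, t)) := by
    simp only [κ, Kernel.map_apply _ hf, Kernel.prod_apply, Kernel.id_apply, Kernel.const_apply,
      Measure.dirac_prod]
    exact Measure.map_map hf measurable_prodMk_left
  have hjoint : μ.map (fun ω => (X ω, Y ω)) = μ.map X ⊗ₘ κ := by
    have hg : Measurable (fun p : ℝ × ℝ => (p.1, f p)) := by fun_prop
    have hmap : μ.map (fun ω => (X ω, Y ω))
        = ((μ.map X).prod (μ.map E)).map (fun p : ℝ × ℝ => (p.1, f p)) := by
      rw [← (indepFun_iff_map_prod_eq_prod_map_map hX.aemeasurable hE.aemeasurable).1 hindep,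
        Measure.map_map hg (hX.prodMk hE), hY]
      rfl
    ext s hs
    rw [hmap, Measure.map_apply hg hs, Measure.prod_apply (hg hs), Measure.compProd_apply hs]
    refine lintegral_congr fun x => ?_
    rw [hκ, Measure.map_apply (by fun_prop) (measurable_prodMk_left hs)]
    rfl
  filter_upwards [condDistrib_ae_eq_of_measure_eq_compProd X hY_meas.aemeasurable hjoint]
    with x hx
  rw [hx, hκ]
end
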